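/- Let A and B be bilinear maps V₂ × V₂ → V₂, regarded as multiplications on V₂. There exists a linear bijection φ : V₂ → V₂ with φ(v₁) = v₁ that is an algebra isomorphism from (V₂, A) to (V₂, B) (i.e., φ(A(x,y)) = B(φ(x), φ(y)) for all x, y) if and only if there exists an algebra automorphism of W(2) sending the element A to the element B. -/

import Mathlib

noncomputable section

variable (F : Type*) [Field F] [CharZero F]

abbrev V2 (F : Type*) [Field F] : Type _ := Fin 2 → F

abbrev WW (F : Type*) [Field F] : Type _ := V2 F →ₗ[F] V2 F →ₗ[F] V2 F

def vone : V2 F := ![1, 0]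

/-- The multiplication on the space of bilinear maps. -/
def wmul (A B : WW F) : WW F :=
  LinearMap.mk₂ F
    (fun x y => A (vone F) (B x y) - B (A (vone F) x) y - B x (A (vone F) y))
    (fun x x' y => by simp only [map_add, LinearMap.add_apply]; abel)
    (fun c x y => by simp only [map_smul, LinearMap.smul_apply, smul_sub])
    (fun x y y' => by simp only [map_add, LinearMap.add_apply]; abel)
    (fun c x y => by simp only [map_smul, LinearMap.smul_apply, smul_sub])

/-- α_{ij}^k -/
def alphaM (i j k : Fin 2) : WW F :=
  LinearMap.mk₂ F (fun x y => (x i * y j) • (Pi.single k (1 : F) : V2 F))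
    (fun x x' y => by simp [add_mul, add_smul])
    (fun c x y => by simp [smul_smul, mul_assoc])
    (fun x y y' => by simp [mul_add, add_smul])
    (fun c x y => by simp [smul_smul, mul_assoc, mul_left_comm])

/-- The basis e₁, …, e₈ of W(2) (indexed 0,…,7). -/
def bE : Fin 8 → WW F :=
  ![alphaM F 0 0 0 - alphaM F 0 1 1 - alphaM F 1 0 1,
    alphaM F 0 0 1,
    alphaM F 1 1 1 - alphaM F 0 1 0 - alphaM F 1 0 0,
    alphaM F 1 1 0,
    (2 : F) • alphaM F 0 0 0 + alphaM F 0 1 1 + alphaM F 1 0 1,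
    (2 : F) • alphaM F 1 1 1 + alphaM F 0 1 0 + alphaM F 1 0 0,
    alphaM F 0 1 0 - alphaM F 1 0 0,
    alphaM F 0 1 1 - alphaM F 1 0 1]

section

variable {K : Type*} [Field K]

theorem wmul_apply (A B : WW K) (x y : V2 K) :
    wmul K A B x y = A (vone K) (B x y) - B (A (vone K) x) y - B x (A (vone K) y) := rfl

@[simp] theorem vone_zero : vone K 0 = 1 := rfl

@[simp] theorem vone_one : vone K 1 = 0 := rfl

/-- The bilinear map `(x, y) ↦ x₀ • a y`, whose left multiplication by `v₁` is `a`. -/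
def extendLeft : Module.End K (V2 K) →ₗ[K] WW K :=
  LinearMap.lsmul K (Module.End K (V2 K)) ∘ₗ LinearMap.proj 0 |>.flip

theorem extendLeft_apply (a : Module.End K (V2 K)) (x : V2 K) :
    extendLeft a x = x 0 • a := rfl

@[simp] theorem extendLeft_vone (a : Module.End K (V2 K)) : extendLeft a (vone K) = a := by
  simp [extendLeft_apply]

/-- The endomorphism `x ↦ (s x₀ + t x₁) z`. -/
def rankOne (s t : K) (z : V2 K) : Module.End K (V2 K) :=
  LinearMap.toSpanSingleton K _ z ∘ₗ (s • LinearMap.proj 0 + t • LinearMap.proj 1)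

@[simp] theorem rankOne_apply (s t : K) (z x : V2 K) :
    rankOne s t z x = (s * x 0 + t * x 1) • z := rfl

/-- Left multiplication in `W(2)` depends only on the operator `A v₁`, and does so faithfully. -/
theorem wmul_left_eq_iff (A A' : WW K) :
    (∀ C, wmul K A C = wmul K A' C) ↔ A (vone K) = A' (vone K) := by
  constructor
  · intro h
    set c := A (vone K) - A' (vone K) with hc
    have key : ∀ (C : WW K) x y, c (C x y) = C (c x) y + C x (c y) := by
      intro C x y
      have := congrArg (fun D : WW K => D x y) (h C)
      simp only [wmul_apply] at this
      simp only [hc, LinearMap.sub_apply, map_sub]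
      linear_combination (exp := 1) this
    have h0 : c (vone K) 0 = 0 := by
      have := congrFun (key (extendLeft 1) (vone K) (vone K)) 0
      simpa [extendLeft_apply] using this
    have hcomm : ∀ b : Module.End K (V2 K), ∀ y, c (b y) = b (c y) := by
      intro b y
      simpa [extendLeft_apply, h0] using key (extendLeft b) (vone K) y
    have hz : c (vone K) = 0 := by
      have := hcomm (rankOne 1 0 (vone K)) (vone K)
      simpa [h0] using this
    have hc0 : c = 0 := by
      refine LinearMap.ext fun z => ?_
      have := hcomm (rankOne 1 0 z) (vone K)
      simpa [hz] using this
    exact sub_eq_zero.1 hc0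
  · intro h C
    refine LinearMap.ext₂ fun x y => ?_
    simp only [wmul_apply, h]

theorem wmul_commutator {A B D : WW K}
    (hD : D (vone K) = A (vone K) * B (vone K) - B (vone K) * A (vone K)) (C : WW K) :
    wmul K D C = wmul K A (wmul K B C) - wmul K B (wmul K A C) := by
  refine LinearMap.ext₂ fun x y => ?_
  simp only [LinearMap.sub_apply, wmul_apply, hD, map_sub, Module.End.mul_apply]
  abel

theorem wmul_eq_neg_iff (A : WW K) :
    (∀ C, wmul K A C = -C) ↔ A (vone K) = 1 := by
  have h1 : ∀ C, wmul K (extendLeft 1) C = -C := fun C => by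
    refine LinearMap.ext₂ fun x y => ?_
    simp [wmul_apply]
  rw [← extendLeft_vone (1 : Module.End K (V2 K)), ← wmul_left_eq_iff]
  simp only [h1]

theorem mul_self_eq_zero_of_commutator (h2 : (2 : K) ≠ 0) {H E : Module.End K (V2 K)} {c : K}
    (hc : c ≠ 0) (h : H * E - E * H = c • E) : E * E = 0 := by
  obtain ⟨M, rfl⟩ := (Matrix.toLinAlgEquiv' (R := K) (n := Fin 2)).surjective H
  obtain ⟨N, rfl⟩ := (Matrix.toLinAlgEquiv' (R := K) (n := Fin 2)).surjective E
  rw [← map_mul, ← map_mul, ← map_sub, ← map_smul] at h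
  replace h := Matrix.toLinAlgEquiv'.injective h
  rw [← map_mul]
  have hij : ∀ i j, (M * N - N * M) i j = (c • N) i j := fun i j => by rw [h]
  have e00 := hij 0 0
  have e01 := hij 0 1
  have e10 := hij 1 0
  have e11 := hij 1 1
  simp only [Matrix.sub_apply, Matrix.mul_apply, Fin.sum_univ_two, Matrix.smul_apply,
    smul_eq_mul] at e00 e01 e10 e11
  have ht : N 1 1 = -N 0 0 := by
    apply mul_left_cancel₀ hc
    linear_combination -e00 - e11
  have hs : N 0 0 * N 0 0 + N 0 1 * N 1 0 = 0 := by
    apply mul_left_cancel₀ (mul_ne_zero h2 hc)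
    rw [ht] at e01 e10 e11
    linear_combination -N 0 0 * e00 - N 0 1 * e10 - N 1 0 * e01 + N 0 0 * e11
  suffices N * N = 0 by rw [this, map_zero]
  ext i j
  fin_cases i <;> fin_cases j <;> simp [Matrix.mul_apply, ht]
  · linear_combination hs
  · ring
  · ring
  · linear_combination hs

/-- A linear unital endomorphism of `𝔤𝔩₂` preserving commutators and not killing the standard
nilpotent is inner. -/
theorem exists_conj_of_commutator (h2 : (2 : K) ≠ 0)
    (σ : Module.End K (V2 K) →ₗ[K] Module.End K (V2 K)) (h1 : σ 1 = 1)
    (hσ : ∀ a b, σ (a * b - b * a) = σ a * σ b - σ b * σ a)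
    (hne : σ (rankOne 0 1 (Pi.single 0 1)) ≠ 0) :
    ∃ φ : V2 K ≃ₗ[K] V2 K, ∀ a x, σ a (φ x) = φ (a x) := by
  set e : Module.End K (V2 K) := rankOne 0 1 (Pi.single 0 1) with he
  set f : Module.End K (V2 K) := rankOne 1 0 (Pi.single 1 1) with hf
  have hhe : (e * f - f * e) * e - e * (e * f - f * e) = (2 : K) • e := by
    refine LinearMap.ext fun x => funext fun i => ?_
    fin_cases i <;> simp [he, hf]
    ring
  have hhf : (e * f - f * e) * f - f * (e * f - f * e) = (-2 : K) • f := by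
    refine LinearMap.ext fun x => funext fun i => ?_
    fin_cases i <;> simp [he, hf]
    ring
  have hHE := congrArg σ hhe
  have hHF := congrArg σ hhf
  have hdec : ∀ a : Module.End K (V2 K), (2 : K) • a =
      (a (Pi.single 0 1) 0 + a (Pi.single 1 1) 1) • (1 : Module.End K (V2 K)) +
      (a (Pi.single 0 1) 0 - a (Pi.single 1 1) 1) • (e * f - f * e) +
      (2 * a (Pi.single 1 1) 0) • e + (2 * a (Pi.single 0 1) 1) • f := by
    intro a
    refine LinearMap.pi_ext' fun j => LinearMap.ext_ring (funext fun i => ?_)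
    fin_cases j <;> fin_cases i <;> simp [he, hf] <;> ring
  rw [map_smul, hσ, hσ] at hHE hHF
  have hEE := mul_self_eq_zero_of_commutator h2 h2 hHE
  have hFF := mul_self_eq_zero_of_commutator h2 (neg_ne_zero.2 h2) hHF
  set E := σ e
  set G := σ f
  have hEGE : E * G * E = E := by
    have h4 : (2 : K) • (E * G * E) = (2 : K) • E := by
      rw [← hHE, two_smul]
      have : E * (E * G) = 0 := by rw [← mul_assoc, hEE, zero_mul]
      have h' : G * E * E = 0 := by rw [mul_assoc, hEE, mul_zero]
      rw [sub_mul, mul_sub, this, h', mul_assoc]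
      abel
    exact smul_right_injective _ h2 h4
  obtain ⟨w, hw⟩ : ∃ w, E w ≠ 0 := by
    by_contra! h
    exact hne (LinearMap.ext h)
  have hEp : E (E w) = 0 := LinearMap.congr_fun hEE w
  have hEGp : E (G (E w)) = E w := LinearMap.congr_fun hEGE w
  have hGGp : G (G (E w)) = 0 := LinearMap.congr_fun hFF (E w)
  let φ₀ : Module.End K (V2 K) := rankOne 1 0 (E w) + rankOne 0 1 (G (E w))
  have hφ₀ : ∀ x, φ₀ x = x 0 • E w + x 1 • G (E w) := fun x => by simp [φ₀]
  have hinj : Function.Injective φ₀ := by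
    refine (injective_iff_map_eq_zero φ₀).2 fun x hx => ?_
    rw [hφ₀] at hx
    have hx1 : x 1 = 0 := by
      have := congrArg E hx
      simpa [hEp, hEGp, hw] using this
    have hx0 : x 0 = 0 := by simpa [hx1, hw] using hx
    funext i
    fin_cases i
    exacts [hx0, hx1]
  refine ⟨LinearEquiv.ofInjectiveEndo φ₀ hinj, fun a x => ?_⟩
  have hE : ∀ x, σ e (φ₀ x) = φ₀ (e x) := fun x => by
    change E (φ₀ x) = _
    simp [hφ₀, he, hEp, hEGp]
  have hG : ∀ x, σ f (φ₀ x) = φ₀ (f x) := fun x => by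
    change G (φ₀ x) = _
    simp [hφ₀, hf, hGGp]
  simp only [LinearEquiv.coe_ofInjectiveEndo]
  apply smul_right_injective _ h2
  have hσa := congrArg σ (hdec a)
  simp only [map_add, map_smul, h1, hσ] at hσa
  have h5 := LinearMap.congr_fun hσa (φ₀ x)
  have h6 := congrArg φ₀ (LinearMap.congr_fun (hdec a) x)
  simp only [LinearMap.add_apply, LinearMap.smul_apply, LinearMap.sub_apply, Module.End.mul_apply,
    Module.End.one_apply, map_add, map_smul, map_sub, hE, hG] at h5 h6
  exact h5.trans h6.symm

/-- A multiplicative linear automorphism of `W(2)` comes from a linear automorphism of `V₂`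
fixing `v₁`. -/
theorem exists_linearEquiv_of_wmul_automorphism (h2 : (2 : K) ≠ 0) (g : WW K ≃ₗ[K] WW K)
    (hg : ∀ X Y, g (wmul K X Y) = wmul K (g X) (g Y)) :
    ∃ φ : V2 K ≃ₗ[K] V2 K, φ (vone K) = vone K ∧
      ∀ A x y, φ (A x y) = g A (φ x) (φ y) := by
  have hwd : ∀ A A' : WW K, A (vone K) = A' (vone K) ↔ g A (vone K) = g A' (vone K) := by
    intro A A'
    rw [← wmul_left_eq_iff, ← wmul_left_eq_iff (g A), g.surjective.forall
      (p := fun C => wmul K (g A) C = wmul K (g A') C)]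
    simp only [← hg, g.injective.eq_iff]
  let σ : Module.End K (V2 K) →ₗ[K] Module.End K (V2 K) :=
    LinearMap.applyₗ (vone K) ∘ₗ g.toLinearMap ∘ₗ extendLeft
  have hσA : ∀ A : WW K, g A (vone K) = σ (A (vone K)) := fun A =>
    (hwd _ _).1 (extendLeft_vone _).symm
  have h1 : σ 1 = 1 := by
    rw [← extendLeft_vone (1 : Module.End K (V2 K)), ← hσA, extendLeft_vone, ← wmul_eq_neg_iff,
      g.surjective.forall]
    intro C
    rw [← hg, (wmul_eq_neg_iff _).2 (extendLeft_vone _)]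
    exact map_neg g C
  have hcomm : ∀ a b, σ (a * b - b * a) = σ a * σ b - σ b * σ a := by
    intro a b
    rw [← extendLeft_vone (σ a * σ b - σ b * σ a)]
    refine (wmul_left_eq_iff (g (extendLeft (a * b - b * a))) _).1 ?_
    rw [g.surjective.forall]
    intro C
    rw [wmul_commutator (D := extendLeft (σ a * σ b - σ b * σ a)) (A := g (extendLeft a)) (B := g (extendLeft b)) (extendLeft_vone _),
      ← hg, wmul_commutator (A := extendLeft a) (B := extendLeft b) (by simp)]
    refine (map_sub g _ _).trans ?_
    rw [hg, hg, hg, hg]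
  have hne : σ (rankOne 0 1 (Pi.single 0 1)) ≠ 0 := by
    intro h
    have h0 : g (extendLeft (rankOne 0 1 (Pi.single 0 1))) (vone K) = g 0 (vone K) := by
      rw [hσA, extendLeft_vone, h, map_zero, LinearMap.zero_apply]
    rw [← hwd, extendLeft_vone] at h0
    simpa using congrFun (LinearMap.congr_fun h0 (Pi.single 1 1)) 0
  obtain ⟨φ, hφ⟩ := exists_conj_of_commutator h2 σ h1 hcomm hne
  obtain ⟨u, hu⟩ := φ.surjective (vone K)
  have key : ∀ (X : Module.End K (V2 K)) (A : WW K) y,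
      g A (φ (X u)) (φ y) = φ (A (X (vone K)) y) := by
    intro X A y
    have hL := LinearMap.congr_fun (hσA (wmul K (extendLeft X) A)) (φ y)
    rw [hφ, hg, wmul_apply, hσA (extendLeft X), extendLeft_vone, hσA A, hφ, hφ, hφ, hφ,
      wmul_apply, extendLeft_vone, ← hu, hφ, map_sub, map_sub, hu] at hL
    linear_combination (exp := 1) -hL
  have hu1 : u 1 = 0 := by
    have := key (rankOne (-u 1) (u 0) (vone K)) (extendLeft 1) (vone K)
    have h0 : rankOne (-u 1) (u 0) (vone K) u = 0 := by
      rw [rankOne_apply, show -u 1 * u 0 + u 0 * u 1 = 0 by ring, zero_smul]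
    rw [h0, map_zero, map_zero, LinearMap.zero_apply, eq_comm, LinearEquiv.map_eq_zero_iff] at this
    simpa [extendLeft_apply] using congrFun this 0
  have huv : u = u 0 • vone K := by
    funext i
    fin_cases i <;> simp [hu1]
  have hu0 : u 0 ≠ 0 := by
    intro h
    rw [h, zero_smul] at huv
    rw [huv, map_zero] at hu
    simpa using congrFun hu 0
  refine ⟨φ ≪≫ₗ LinearEquiv.smulOfNeZero K _ (u 0) hu0, ?_, fun A x y => ?_⟩
  · have : φ (u 0 • vone K) = vone K := by rw [← huv, hu]
    simpa using this
  · have := key (rankOne 1 0 x) A y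
    simp at this
    simp [this]

end

/-- Two multiplications on V₂ are isomorphic via an isomorphism fixing v₁ iff
some automorphism of W(2) sends one to the other. -/
theorem statement15 (A B : WW F) :
    (∃ φ : V2 F ≃ₗ[F] V2 F, φ (vone F) = vone F ∧
      ∀ x y : V2 F, φ (A x y) = B (φ x) (φ y)) ↔
    (∃ g : WW F ≃ₗ[F] WW F, (∀ X Y : WW F, g (wmul F X Y) = wmul F (g X) (g Y)) ∧
      g A = B) := by
  constructor
  · rintro ⟨φ, h1, hφ⟩
    have hs : φ.symm (vone F) = vone F := by rw [LinearEquiv.symm_apply_eq, h1]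
    refine ⟨φ.arrowCongr (φ.arrowCongr φ), fun X Y => ?_, ?_⟩
    · refine LinearMap.ext₂ fun x y => ?_
      simp [wmul_apply, LinearEquiv.arrowCongr_apply, hs]
    · refine LinearMap.ext₂ fun x y => ?_
      simp [LinearEquiv.arrowCongr_apply, hφ]
  · rintro ⟨g, hg, rfl⟩
    obtain ⟨φ, h1, hφ⟩ := exists_linearEquiv_of_wmul_automorphism two_ne_zero g hg
    exact ⟨φ, h1, hφ A⟩

end
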